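/- Let m ≥ 1 and let Ω ⊆ ℝ^{2m+1} be a nonempty open, bounded, convex set with boundary Σ := ∂Ω. Then for every X ∈ Ω there exist s, s' ∈ Σ such that s·s' = X·X (Heisenberg product); consequently the Heisenberg product set Σ·Σ := {s·s' : s, s' ∈ Σ} contains the set {X·X : X ∈ Ω} = {2X : X ∈ Ω}, which is a nonempty open subset of ℝ^{2m+1}. (This is the key geometric step, in the Heisenberg case, of the lemma showing that smooth densities on boundaries of convex domains satisfy the curvature assumption.) -/

import Mathlib

open MeasureTheory ENNReal Real Filter
open scoped Pointwise

noncomputable section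

/-- The horizontal layer `ℝ^{2m}` with the Euclidean norm. -/
abbrev Vm (m : ℕ) := EuclideanSpace ℝ (Fin (2 * m))

/-- The Heisenberg group `ℍ^m = ℝ^{2m} × ℝ` (product coordinates `(x, u)`). -/
abbrev HP (m : ℕ) := Vm m × ℝ

/-- The symplectic form `x^⊤Jy = (1/2) ∑_{j=1}^m (x_j y_{m+j} - x_{m+j} y_j)`. -/
def sympV (m : ℕ) (x y : Vm m) : ℝ :=
  (1 / 2) * ∑ j : Fin m,
    (x ⟨(j : ℕ), by omega⟩ * y ⟨m + (j : ℕ), by omega⟩ -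
      x ⟨m + (j : ℕ), by omega⟩ * y ⟨(j : ℕ), by omega⟩)

/-- The Heisenberg group product `(x,u)·(y,v) = (x + y, u + v + x^⊤Jy)`. -/
def pmul (m : ℕ) (z w : HP m) : HP m :=
  (z.1 + w.1, z.2 + w.2 + sympV m z.1 w.1)

/-- The Heisenberg group inverse `(x,u)⁻¹ = (-x,-u)`. -/
def pinv (m : ℕ) (z : HP m) : HP m := (-z.1, -z.2)

/-- Every point of a bounded open convex set is the midpoint of a chord whose direction lies in the
span of two given linearly independent vectors. -/
lemma exists_symmetric_frontier_pair {E : Type*} [NormedAddCommGroup E] [NormedSpace ℝ E]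
    {Ω : Set E} (hop : IsOpen Ω) (hbd : Bornology.IsBounded Ω) (hcv : Convex ℝ Ω)
    {X : E} (hX : X ∈ Ω) (a b : E)
    (hab : ∀ θ : ℝ, Real.cos θ • a + Real.sin θ • b ≠ 0) :
    ∃ p q : ℝ, X + (p • a + q • b) ∈ frontier Ω ∧ X - (p • a + q • b) ∈ frontier Ω := by
  set K : Set E := (fun v => X + v) ⁻¹' Ω with hK
  have hKo : IsOpen K := hop.preimage (by fun_prop)
  have hK0 : K ∈ nhds (0 : E) := hKo.mem_nhds (by simpa [hK] using hX)
  have hKc : Convex ℝ K := hcv.translate_preimage_right X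
  have hKb : Bornology.IsBounded K :=
    (IsometryEquiv.addLeft X).isometry.antilipschitz.isBounded_preimage hbd
  have hKf : ∀ v, gauge K v = 1 → X + v ∈ frontier Ω := by
    intro v hv
    have h1 : v ∈ frontier K := (gauge_eq_one_iff_mem_frontier hKc hK0).1 hv
    have h2 : (Homeomorph.addLeft X) ⁻¹' frontier Ω = frontier K :=
      (Homeomorph.addLeft X).preimage_frontier Ω
    rw [← h2] at h1
    exact h1
  have hg : Continuous (gauge K) := continuous_gauge hKc hK0
  set v : ℝ → E := fun θ => Real.cos θ • a + Real.sin θ • b with hv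
  have hvc : Continuous v := by fun_prop
  have hvπ : v π = -v 0 := by simp [hv]
  set f : ℝ → ℝ := fun θ => gauge K (v θ) - gauge K (-v θ) with hf
  have hfc : Continuous f := (hg.comp hvc).sub (hg.comp hvc.neg)
  have hfπ : f π = -f 0 := by simp [hf, hvπ]
  obtain ⟨θ, hθ⟩ : ∃ θ, f θ = 0 := by
    rcases le_total (f 0) 0 with h | h
    · exact mem_range_of_exists_le_of_exists_ge hfc ⟨0, h⟩ ⟨π, by linarith⟩
    · exact mem_range_of_exists_le_of_exists_ge hfc ⟨π, by linarith⟩ ⟨0, h⟩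
  have hpos : 0 < gauge K (v θ) :=
    (gauge_pos (absorbent_nhds_zero hK0)
      ((NormedSpace.isVonNBounded_iff ℝ).2 hKb)).2 (hab θ)
  set r : ℝ := (gauge K (v θ))⁻¹ with hr
  have hr0 : 0 ≤ r := (inv_pos.2 hpos).le
  have hrv : r • v θ = (r * Real.cos θ) • a + (r * Real.sin θ) • b := by
    simp [hv, smul_add, smul_smul]
  have hneg : gauge K (-v θ) = gauge K (v θ) := (sub_eq_zero.1 hθ).symm
  refine ⟨r * Real.cos θ, r * Real.sin θ, ?_, ?_⟩
  · rw [← hrv]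
    apply hKf
    rw [gauge_smul_of_nonneg hr0, smul_eq_mul, hr, inv_mul_cancel₀ hpos.ne']
  · rw [← hrv, sub_eq_add_neg, ← smul_neg]
    apply hKf
    rw [gauge_smul_of_nonneg hr0, smul_eq_mul, hneg, hr, inv_mul_cancel₀ hpos.ne']

lemma sympV_self (m : ℕ) (x : Vm m) : sympV m x x = 0 := by
  unfold sympV
  rw [Finset.sum_eq_zero fun j _ => by ring, mul_zero]

lemma sympV_add_smul_sub_smul (m : ℕ) (x h : Vm m) (p : ℝ) :
    sympV m (x + p • h) (x - p • h) = -2 * p * sympV m x h := by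
  simp only [sympV, PiLp.add_apply, PiLp.sub_apply, PiLp.smul_apply, smul_eq_mul,
    Finset.mul_sum]
  exact Finset.sum_congr rfl fun j _ => by ring

lemma pmul_self (m : ℕ) (X : HP m) : pmul m X X = (2 : ℝ) • X := by
  ext1
  · simp [pmul, two_smul]
  · simp [pmul, sympV_self, two_mul]

lemma exists_ne_zero_sympV_eq_zero {m : ℕ} (hm : 1 ≤ m) (x : Vm m) :
    ∃ h : Vm m, h ≠ 0 ∧ sympV m x h = 0 := by
  by_cases hx : x = 0
  · have : Nonempty (Fin (2 * m)) := ⟨⟨0, by omega⟩⟩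
    obtain ⟨h, hh⟩ := exists_ne (0 : Vm m)
    exact ⟨h, hh, by simp [sympV, hx]⟩
  · exact ⟨x, hx, sympV_self m x⟩

lemma exists_frontier_pmul_eq_pmul_self {m : ℕ} (hm : 1 ≤ m) {Ω : Set (HP m)} (hop : IsOpen Ω)
    (hbd : Bornology.IsBounded Ω) (hcv : Convex ℝ Ω) {X : HP m} (hX : X ∈ Ω) :
    ∃ s ∈ frontier Ω, ∃ s' ∈ frontier Ω, pmul m s s' = pmul m X X := by
  obtain ⟨h, hh, hs⟩ := exists_ne_zero_sympV_eq_zero hm X.1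
  have hab : ∀ θ : ℝ, Real.cos θ • ((h, 0) : HP m) + Real.sin θ • ((0, 1) : HP m) ≠ 0 := by
    intro θ h0
    have h1 : Real.cos θ = 0 := by simpa [hh] using congrArg Prod.fst h0
    have h2 : Real.sin θ = 0 := by simpa using congrArg Prod.snd h0
    simpa [h1, h2] using Real.sin_sq_add_cos_sq θ
  obtain ⟨p, q, h1, h2⟩ := exists_symmetric_frontier_pair hop hbd hcv hX _ _ hab
  refine ⟨_, h1, _, h2, ?_⟩
  rw [pmul_self]
  ext1
  · simp [pmul, two_smul]
  · simp [pmul, sympV_add_smul_sub_smul, hs, two_mul]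

/-- **Key geometric step for convex bodies in `ℍ^m`:** if `Ω ⊆ ℝ^{2m+1}` is a nonempty
open bounded convex set with boundary `Σ = ∂Ω`, then for every `X ∈ Ω` there are
`s, s' ∈ Σ` with `s·s' = X·X` (Heisenberg product); consequently the Heisenberg product
set `Σ·Σ` contains `{X·X : X ∈ Ω} = 2 • Ω`, a nonempty open subset of `ℝ^{2m+1}`. -/
theorem convex_boundary_square_trick (m : ℕ) (hm : 1 ≤ m)
    (Ω : Set (HP m)) (hne : Ω.Nonempty) (hop : IsOpen Ω)
    (hbd : Bornology.IsBounded Ω) (hcv : Convex ℝ Ω) :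
    (∀ X ∈ Ω, ∃ s ∈ frontier Ω, ∃ s' ∈ frontier Ω, pmul m s s' = pmul m X X) ∧
      {z : HP m | ∃ X ∈ Ω, z = pmul m X X} ⊆
        {z : HP m | ∃ s ∈ frontier Ω, ∃ s' ∈ frontier Ω, z = pmul m s s'} ∧
      {z : HP m | ∃ X ∈ Ω, z = pmul m X X} = (2 : ℝ) • Ω ∧
      IsOpen ((2 : ℝ) • Ω) ∧ ((2 : ℝ) • Ω).Nonempty := by
  have key : ∀ X ∈ Ω, ∃ s ∈ frontier Ω, ∃ s' ∈ frontier Ω, pmul m s s' = pmul m X X :=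
    fun X hX => exists_frontier_pmul_eq_pmul_self hm hop hbd hcv hX
  refine ⟨key, ?_, ?_, hop.smul₀ two_ne_zero, hne.smul_set⟩
  · rintro z ⟨X, hX, rfl⟩
    obtain ⟨s, hs, s', hs', h⟩ := key X hX
    exact ⟨s, hs, s', hs', h.symm⟩
  · ext z
    simp only [Set.mem_ofPred_eq, pmul_self, Set.mem_smul_set, eq_comm]
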